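/- arXiv:2006.09647 — 2 statements merged into one kernel-verified Lean document; each statement's English description precedes it below -/
import Mathlib

section
/- Let θ* ∈ ℝ, let i > 0 (the Fisher information scalar), and let ε ∈ (0,1). Let q > 0 satisfy gammaMeasure (1/2) (1/2) (Set.Iic q) = ENNReal.ofReal (1 − ε). For each m ≥ 1, let T_m and T'_m be real-valued random variables on a probability space (Ω, P) such that T_m and T'_m are independent, and suppose the law of ω ↦ √m · (T_m ω − θ*) and the law of ω ↦ √m · (T'_m ω − θ*) both converge weakly (in the topology of weak convergence of probability measures on ℝ) to gaussianReal 0 (1/i) as m → ∞. Then P { ω | i · (T_m ω − T'_m ω)^2 ≥ (2/m) · q } tends to ENNReal.ofReal ε as m → ∞. -/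
open MeasureTheory ProbabilityTheory Filter Topology

/-- The centred Gaussian mass of a symmetric interval is twice the mass of its positive half. -/
lemma gaussianReal_Ioo_neg_self {v : NNReal} (hv : v ≠ 0) {s : ℝ} (hs : 0 < s) :
    gaussianReal 0 v (Set.Ioo (-s) s) = 2 * gaussianReal 0 v (Set.Ioo 0 s) := by
  have := nullSingletonClass_gaussianReal (μ := 0) hv
  have hneg : gaussianReal 0 v (Set.Ioo (-s) 0) = gaussianReal 0 v (Set.Ioo 0 s) := by
    conv_lhs => rw [← neg_zero (G := ℝ), ← gaussianReal_map_neg]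
    rw [Measure.map_apply measurable_neg measurableSet_Ioo]
    congr 1
    ext x
    simp [and_comm]
  rw [← Set.Ioc_union_Ioo_eq_Ioo (neg_lt_zero.2 hs).le hs,
    measure_union ((Set.Ioc_disjoint_Ioi le_rfl).mono_right Set.Ioo_subset_Ioi_self)
      measurableSet_Ioo,
    measure_congr Ioo_ae_eq_Ioc.symm, hneg, two_mul]

/-- Substituting `x ^ 2` in the chi-squared density gives twice the standard Gaussian density. -/
lemma ofReal_two_mul_mul_gammaPDF_sq {x : ℝ} (hx : 0 < x) :
    ENNReal.ofReal |2 * x| * gammaPDF (1 / 2) (1 / 2) (x ^ 2) = 2 * gaussianPDF 0 1 x := by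
  have hpow : (x ^ 2) ^ ((1 : ℝ) / 2 - 1) = x⁻¹ := by
    rw [← Real.rpow_natCast, ← Real.rpow_mul hx.le]
    norm_num [Real.rpow_neg_one]
  have hconst : ((1 : ℝ) / 2) ^ ((1 : ℝ) / 2) / √Real.pi = (√(2 * Real.pi))⁻¹ := by
    rw [← Real.sqrt_eq_rpow, ← Real.sqrt_div (by positivity), ← Real.sqrt_inv]
    congr 1
    field_simp
  rw [gammaPDF_of_nonneg (sq_nonneg x), Real.Gamma_one_half_eq, hpow, hconst, gaussianPDF,
    gaussianPDFReal_def, ← ENNReal.ofReal_mul (abs_nonneg _), abs_of_pos (by positivity),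
    ← ENNReal.ofReal_ofNat 2, ← ENNReal.ofReal_mul zero_le_two]
  congr 1
  have hexp : -(1 / 2 * x ^ 2) = -(x - 0) ^ 2 / (2 * ((1 : NNReal) : ℝ)) := by
    push_cast
    ring
  rw [hexp]
  simp only [NNReal.coe_one, mul_one]
  field_simp

/-- The square of a standard Gaussian variable is chi-squared distributed with one degree of
freedom. -/
lemma gammaMeasure_half_half_Iic {q : ℝ} (hq : 0 < q) :
    gammaMeasure (1 / 2) (1 / 2) (Set.Iic q) =
      gaussianReal 0 1 (Set.Ioo (-√q) √q) := by
  have hs : 0 < √q := Real.sqrt_pos.2 hq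
  have himage : (fun x : ℝ => x ^ 2) '' Set.Ioo 0 √q = Set.Ioo 0 q := by
    ext y
    constructor
    · rintro ⟨x, ⟨hx0, hx⟩, rfl⟩
      exact ⟨by positivity, (Real.lt_sqrt hx0.le).1 hx⟩
    · rintro ⟨hy0, hy⟩
      exact ⟨√y, ⟨Real.sqrt_pos.2 hy0, Real.sqrt_lt_sqrt hy0.le hy⟩, Real.sq_sqrt hy0.le⟩
  have hinj : Set.InjOn (fun x : ℝ => x ^ 2) (Set.Ioo 0 √q) := fun x hx y hy h =>
    (pow_left_inj₀ hx.1.le hy.1.le two_ne_zero).1 h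
  rw [gaussianReal_Ioo_neg_self one_ne_zero hs, gaussianReal_apply 0 one_ne_zero,
    gammaMeasure, withDensity_apply _ measurableSet_Iic,
    lintegral_Iic_eq_lintegral_Iio_add_Icc _ hq.le, lintegral_gammaPDF_of_nonpos le_rfl, zero_add,
    ← setLIntegral_congr Ioo_ae_eq_Icc, ← himage,
    lintegral_image_eq_lintegral_abs_deriv_mul (f' := fun x => 2 * x) measurableSet_Ioo
      (fun x _ => by simpa using (hasDerivAt_pow 2 x).hasDerivWithinAt) hinj,
    ← lintegral_const_mul _ (measurable_gaussianPDF 0 1)]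
  exact setLIntegral_congr_fun measurableSet_Ioo fun x hx => ofReal_two_mul_mul_gammaPDF_sq hx.1

/-- The difference of two independent centred Gaussian variables of variance `1 / i`, rescaled by
`√(i / 2)`, is standard Gaussian. -/
lemma map_sqrt_half_mul_sub_gaussianReal_prod {i : ℝ} (hi : 0 < i) :
    ((gaussianReal 0 (Real.toNNReal (1 / i))).prod (gaussianReal 0 (Real.toNNReal (1 / i)))).map
      (fun p : ℝ × ℝ => √(i / 2) * (p.1 - p.2)) = gaussianReal 0 1 := by
  set γ := gaussianReal 0 (Real.toNNReal (1 / i))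
  have hscale (c : ℝ) (hc : c ^ 2 = i / 2) : γ.map (c * ·) = gaussianReal 0 (1 / 2) := by
    rw [gaussianReal_map_const_mul, mul_zero]
    congr 1
    ext
    simp only [NNReal.coe_mul, NNReal.coe_mk, hc, Real.coe_toNNReal _ (by positivity : 0 ≤ 1 / i)]
    push_cast
    field_simp
  have hsqrt : √(i / 2) ^ 2 = i / 2 := Real.sq_sqrt (by positivity)
  have hfst : (γ.prod γ).map ((√(i / 2) * ·) ∘ Prod.fst) = gaussianReal 0 (1 / 2) := by
    rw [← Measure.map_map (by fun_prop) measurable_fst, Measure.map_fst_prod, measure_univ,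
      one_smul, hscale _ hsqrt]
  have hsnd : (γ.prod γ).map ((-√(i / 2) * ·) ∘ Prod.snd) = gaussianReal 0 (1 / 2) := by
    rw [← Measure.map_map (by fun_prop) measurable_snd, Measure.map_snd_prod, measure_univ,
      one_smul, hscale _ (by rw [neg_sq, hsqrt])]
  have hadd := gaussianReal_add_gaussianReal_of_indepFun
    (indepFun_prod (μ := γ) (ν := γ) (X := fun x : ℝ => √(i / 2) * x)
      (Y := fun x : ℝ => -√(i / 2) * x) (by fun_prop) (by fun_prop)) hfst hsnd
  rw [add_zero, add_halves] at hadd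
  rw [← hadd]
  congr 1
  ext p
  simp only [Pi.add_apply]
  ring

/-- Theorem 1 of the paper for r = 1: if the two independent estimator sequences are
asymptotically normal and efficient around a common parameter `θ*` (the null
hypothesis), then the false positive rate of the audit test converges to `ε`. -/
theorem audit_false_positive_rate_asymptotic
    (θstar : ℝ) (i : ℝ) (hi : 0 < i)
    (ε : ℝ) (hε : ε ∈ Set.Ioo (0 : ℝ) 1)
    (q : ℝ) (hq : 0 < q)
    (hquant : gammaMeasure (1 / 2) (1 / 2) (Set.Iic q) = ENNReal.ofReal (1 - ε))
    {Ω : Type*} [MeasurableSpace Ω] (P : Measure Ω) [IsProbabilityMeasure P]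
    (T T' : ℕ → Ω → ℝ)
    (hT : ∀ m, Measurable (T m)) (hT' : ∀ m, Measurable (T' m))
    (hindep : ∀ m, IndepFun (T m) (T' m) P)
    (μs μs' : ℕ → ProbabilityMeasure ℝ)
    (hμs : ∀ m, (μs m : Measure ℝ) = P.map (fun ω => Real.sqrt m * (T m ω - θstar)))
    (hμs' : ∀ m, (μs' m : Measure ℝ) = P.map (fun ω => Real.sqrt m * (T' m ω - θstar)))
    (hlim : Tendsto μs atTop
      (𝓝 (⟨gaussianReal 0 (Real.toNNReal (1 / i)), inferInstance⟩ : ProbabilityMeasure ℝ)))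
    (hlim' : Tendsto μs' atTop
      (𝓝 (⟨gaussianReal 0 (Real.toNNReal (1 / i)), inferInstance⟩ : ProbabilityMeasure ℝ))) :
    Tendsto (fun m : ℕ => P {ω | i * (T m ω - T' m ω) ^ 2 ≥ (2 / m) * q})
      atTop (𝓝 (ENNReal.ofReal ε)) := by
  have hs : 0 < √q := Real.sqrt_pos.2 hq
  have := nullSingletonClass_gaussianReal (μ := 0) (one_ne_zero (α := NNReal))
  have hf : Continuous (fun p : ℝ × ℝ => √(i / 2) * (p.1 - p.2)) := by fun_prop
  have hlimit : Tendsto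
      (fun m => ((μs m).prod (μs' m)).map hf.measurable.aemeasurable) atTop
      (𝓝 (⟨gaussianReal 0 1, inferInstance⟩ : ProbabilityMeasure ℝ)) := by
    have hlaw : (ProbabilityMeasure.prod ⟨gaussianReal 0 (Real.toNNReal (1 / i)), inferInstance⟩
        ⟨gaussianReal 0 (Real.toNNReal (1 / i)), inferInstance⟩).map hf.measurable.aemeasurable =
        (⟨gaussianReal 0 1, inferInstance⟩ : ProbabilityMeasure ℝ) :=
      Subtype.ext (map_sqrt_half_mul_sub_gaussianReal_prod hi)
    rw [← hlaw]
    exact ProbabilityMeasure.tendsto_map_of_tendsto_of_continuous _ _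
      ((ProbabilityMeasure.continuous_prod.tendsto _).comp (hlim.prodMk_nhds hlim')) hf
  have hfrontier : gaussianReal 0 1 (frontier (Set.Ioo (-√q) √q)ᶜ) = 0 := by
    rw [frontier_compl, frontier_Ioo (by linarith)]
    exact (Set.toFinite _).measure_zero _
  have hrejection : gaussianReal 0 1 (Set.Ioo (-√q) √q)ᶜ = ENNReal.ofReal ε := by
    rw [prob_compl_eq_one_sub measurableSet_Ioo, ← gammaMeasure_half_half_Iic hq, hquant,
      ← ENNReal.ofReal_one, ← ENNReal.ofReal_sub _ (by linarith [hε.2]), sub_sub_cancel]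
  have hmass := ProbabilityMeasure.tendsto_measure_of_null_frontier_of_tendsto' hlimit hfrontier
  simp only [ProbabilityMeasure.toMeasure_map, ProbabilityMeasure.toMeasure_prod,
    ProbabilityMeasure.coe_mk, hrejection] at hmass
  refine hmass.congr' ?_
  filter_upwards [eventually_gt_atTop 0] with m hm
  have hm' : (0 : ℝ) < m := Nat.cast_pos.2 hm
  have hX : Measurable fun ω => √m * (T m ω - θstar) := by have := hT m; fun_prop
  have hX' : Measurable fun ω => √m * (T' m ω - θstar) := by have := hT' m; fun_prop
  have hindep' : IndepFun (fun ω => √m * (T m ω - θstar)) (fun ω => √m * (T' m ω - θstar)) P :=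
    (hindep m).comp (φ := fun x => √m * (x - θstar)) (ψ := fun x => √m * (x - θstar))
      (by fun_prop) (by fun_prop)
  rw [hμs, hμs', ← (indepFun_iff_map_prod_eq_prod_map_map hX.aemeasurable hX'.aemeasurable).1
    hindep', Measure.map_map hf.measurable (hX.prodMk hX'),
    Measure.map_apply (hf.measurable.comp (hX.prodMk hX')) measurableSet_Ioo.compl]
  congr 1
  ext ω
  have hsq : (√(i / 2) * (√m * (T m ω - θstar) - √m * (T' m ω - θstar))) ^ 2 =
      m / 2 * (i * (T m ω - T' m ω) ^ 2) := by
    rw [← mul_sub, sub_sub_sub_cancel_right, mul_pow, mul_pow, Real.sq_sqrt (by positivity),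
      Real.sq_sqrt hm'.le]
    ring
  rw [Set.mem_preimage, Set.mem_compl_iff, Set.mem_Ioo, ← abs_lt, not_lt, Function.comp_apply,
    Real.sqrt_le_left (abs_nonneg _), sq_abs, hsq, Set.mem_ofPred_eq, ge_iff_le,
    ← div_le_iff₀' (by positivity)]
  rw [show q / (m / 2 : ℝ) = 2 / m * q by field_simp]
end

section
/- Let r ≥ 1 be a natural number. The pushforward of the product measure ⊗_{j : Fin r} gaussianReal 0 1 (the law of r i.i.d. standard Gaussian random variables) under the map g ↦ ∑_{j : Fin r} (g j)² equals gammaMeasure (r/2) (1/2). In other words, the sum of squares of r independent standard Gaussian random variables has the chi-squared distribution with r degrees of freedom. -/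
open MeasureTheory ProbabilityTheory

lemma mgf_id_gammaMeasure_eq_integral {a r : ℝ} (ha : 0 < a) (hr : 0 < r) (t : ℝ) :
    mgf id (gammaMeasure a r) t =
      r ^ a / Real.Gamma a * ∫ x in Set.Ioi 0, x ^ (a - 1) * Real.exp (-((r - t) * x)) := by
  have hpdf (x : ℝ) : (gammaPDF a r x).toReal • Real.exp (t * id x) =
      (Set.Ici 0).indicator (fun x : ℝ ↦ r ^ a / Real.Gamma a *
        (x ^ (a - 1) * Real.exp (-((r - t) * x)))) x := by
    rw [gammaPDF, ENNReal.toReal_ofReal (gammaPDFReal_nonneg ha hr x), gammaPDFReal]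
    by_cases hx : 0 ≤ x
    · rw [if_pos hx, Set.indicator_of_mem (Set.mem_Ici.2 hx), smul_eq_mul, mul_assoc, mul_assoc,
        ← Real.exp_add, id]
      ring_nf
    · rw [if_neg hx, Set.indicator_of_notMem (by simpa using hx), zero_smul]
  have hmeas : Measurable (gammaPDF a r) := (measurable_gammaPDFReal a r).ennreal_ofReal
  rw [mgf, gammaMeasure, integral_withDensity_eq_integral_toReal_smul hmeas
    (ae_of_all _ fun _ ↦ ENNReal.ofReal_lt_top)]
  simp_rw [hpdf]
  rw [integral_indicator measurableSet_Ici, integral_Ici_eq_integral_Ioi, integral_const_mul]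

/-- The moment generating function of the Gamma distribution with shape `a` and rate `r`,
below the rate. -/
lemma mgf_id_gammaMeasure_of_lt {a r t : ℝ} (ha : 0 < a) (hr : 0 < r) (ht : t < r) :
    mgf id (gammaMeasure a r) t = (r / (r - t)) ^ a := by
  have hrt : 0 < r - t := sub_pos.2 ht
  rw [mgf_id_gammaMeasure_eq_integral ha hr, Real.integral_rpow_mul_exp_neg_mul_Ioi ha hrt,
    div_eq_mul_one_div r, Real.mul_rpow hr.le (by positivity)]
  field_simp [(Real.Gamma_pos_of_pos ha).ne']

/-- The exponential moments of the Gamma distribution are infinite at and above the rate, so that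
its moment generating function takes the default value there. -/
lemma mgf_id_gammaMeasure_of_le {a r t : ℝ} (ha : 0 < a) (hr : 0 < r) (ht : r ≤ t) :
    mgf id (gammaMeasure a r) t = 0 := by
  rw [mgf_id_gammaMeasure_eq_integral ha hr, integral_undef, mul_zero]
  refine fun hint ↦ not_integrableOn_Ioi_rpow (a - 1) (hint.mono' (by fun_prop) ?_)
  filter_upwards [ae_restrict_mem measurableSet_Ioi] with x hx
  have hx : 0 < x := hx
  rw [Real.norm_of_nonneg (by positivity)]
  refine le_mul_of_one_le_right (by positivity) (Real.one_le_exp ?_)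
  nlinarith

/-- The moment generating function of the square of a standard Gaussian random variable. Both
sides vanish for `1 / 2 ≤ t`. -/
lemma mgf_sq_gaussianReal (t : ℝ) :
    mgf (fun x ↦ x ^ 2) (gaussianReal 0 1) t = √((1 / 2) / (1 / 2 - t)) := by
  have hpdf (x : ℝ) : gaussianPDFReal 0 1 x • Real.exp (t * x ^ 2) =
      (√(2 * Real.pi))⁻¹ * Real.exp (-(1 / 2 - t) * x ^ 2) := by
    rw [gaussianPDFReal, smul_eq_mul, mul_assoc, ← Real.exp_add]
    simp only [NNReal.coe_one, mul_one]
    ring_nf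
  rw [mgf, integral_gaussianReal_eq_integral_smul one_ne_zero]
  simp_rw [hpdf]
  rw [integral_const_mul, integral_gaussian, ← Real.sqrt_inv, ← Real.sqrt_mul (by positivity)]
  congr 1
  field_simp

/-- Probability measures on `ℝ` with the same moment generating function are equal if it is finite
around `0`. -/
lemma ext_of_mgf_id_eq {μ ν : Measure ℝ} [IsProbabilityMeasure μ] [IsProbabilityMeasure ν]
    (h : mgf id μ = mgf id ν) (h0 : 0 ∈ interior (integrableExpSet id μ)) : μ = ν := by
  refine Measure.ext_of_charFun (funext fun t ↦ ?_)
  rw [← complexMGF_id_mul_I, ← complexMGF_id_mul_I]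
  exact eqOn_complexMGF_of_mgf h (by simpa using h0)

/-- The sum of squares of `r` independent standard Gaussian random variables has the
chi-squared distribution with `r` degrees of freedom. -/
theorem sum_sq_std_gaussian_chiSq
    (r : ℕ) (hr : 1 ≤ r) :
    Measure.map (fun g : Fin r → ℝ => ∑ j : Fin r, (g j) ^ 2)
        (Measure.pi (fun _ : Fin r => gaussianReal 0 1)) =
      gammaMeasure (r / 2 : ℝ) (1 / 2) := by
  have ha : (0 : ℝ) < r / 2 := by positivity
  have hmeas : Measurable fun g : Fin r → ℝ ↦ ∑ j : Fin r, (g j) ^ 2 := by fun_prop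
  have := isProbabilityMeasure_gammaMeasure ha one_half_pos
  have := Measure.isProbabilityMeasure_map (μ := Measure.pi fun _ : Fin r ↦ gaussianReal 0 1)
    hmeas.aemeasurable
  refine (ext_of_mgf_id_eq (funext fun t ↦ ?_) ?_).symm
  · have hpow : mgf id (Measure.map (fun g : Fin r → ℝ ↦ ∑ j : Fin r, (g j) ^ 2)
        (Measure.pi fun _ : Fin r ↦ gaussianReal 0 1)) t = √((1 / 2) / (1 / 2 - t)) ^ r := by
      rw [mgf_id_map hmeas.aemeasurable, mgf]
      simp_rw [Finset.mul_sum, Real.exp_sum]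
      rw [integral_fintype_prod_eq_pow (fun x : ℝ ↦ Real.exp (t * x ^ 2)), Fintype.card_fin,
        ← mgf_sq_gaussianReal, mgf]
    rw [hpow]
    rcases lt_or_ge t (1 / 2) with ht | ht
    · have hpos : 0 < 1 / 2 - t := sub_pos.2 ht
      rw [mgf_id_gammaMeasure_of_lt ha one_half_pos ht, Real.sqrt_eq_rpow, ← Real.rpow_natCast,
        ← Real.rpow_mul (by positivity)]
      ring_nf
    · rw [mgf_id_gammaMeasure_of_le ha one_half_pos ht, Real.sqrt_eq_zero_of_nonpos
        (div_nonpos_of_nonneg_of_nonpos (by norm_num) (sub_nonpos.2 ht)), zero_pow (by omega)]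
  · refine mem_interior.2 ⟨Set.Iio (1 / 2), fun t ht ↦ ?_, isOpen_Iio, by simp⟩
    have hpos : 0 < 1 / 2 - t := sub_pos.2 ht
    refine Integrable.of_integral_ne_zero ?_
    rw [← mgf, mgf_id_gammaMeasure_of_lt ha one_half_pos ht]
    positivity
end
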